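/- arXiv:2205.09155 — 2 statements merged into one kernel-verified Lean document; each statement's English description precedes it below -/
import Mathlib

section
/- Let A and B be nonempty, disjoint, closed, connected subsets of the Euclidean plane ℝ². Then the equidistant set E(A,B) is a connected topological 1-manifold without boundary; that is, E(A,B) is connected and every point of E(A,B) has an open neighborhood in the subspace topology that is homeomorphic to ℝ. -/
open Metric Set

/-- The equidistant set determined by two subsets of a metric space. -/
def equidistantSet {X : Type*} [MetricSpace X] (A B : Set X) : Set X :=
  {x | Metric.infDist x A = Metric.infDist x B}

/-- Two continuous logarithms of proportional functions differ by a constant on a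
preconnected set. -/
theorem IsPreconnected.sub_eq_sub_of_exp_eq_mul_exp {X : Type*} [TopologicalSpace X] {S : Set X}
    (hS : IsPreconnected S) {F G : X → ℂ} (hF : ContinuousOn F S) (hG : ContinuousOn G S) {k : ℂ}
    (h : ∀ z ∈ S, Complex.exp (F z) = k * Complex.exp (G z)) {x y : X} (hx : x ∈ S) (hy : y ∈ S) :
    F x - F y = G x - G y := by
  have hT : IsDiscrete (range fun n : ℤ ↦ (n : ℝ)) :=
    isDiscrete_iff_discreteTopology.mpr
      (Int.isClosedEmbedding_coe_real.isEmbedding.toHomeomorph.symm.isEmbedding.discreteTopology)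
  have key : ∀ z ∈ S, ∃ n : ℤ, (F z - G z) - (F y - G y) = n * (2 * Real.pi * Complex.I) := by
    intro z hz
    have hk : Complex.exp (F z - G z) = Complex.exp (F y - G y) := by
      rw [Complex.exp_sub, Complex.exp_sub, h z hz, h y hy,
        mul_div_cancel_right₀ _ (Complex.exp_ne_zero _),
        mul_div_cancel_right₀ _ (Complex.exp_ne_zero _)]
    obtain ⟨n, hn⟩ := Complex.exp_eq_exp_iff_exists_int.1 hk
    exact ⟨n, by rw [hn]; ring⟩
  have hpi : (Real.pi : ℂ) ≠ 0 := by exact_mod_cast Real.pi_ne_zero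
  let D : X → ℝ := fun z ↦ (((F z - G z) - (F y - G y)) / (2 * Real.pi * Complex.I)).re
  have hD : ContinuousOn D S :=
    Complex.continuous_re.comp_continuousOn
      (((hF.sub hG).sub continuousOn_const).div_const _)
  have hDn : ∀ z ∈ S, ∀ n : ℤ, (F z - G z) - (F y - G y) = n * (2 * Real.pi * Complex.I) →
      D z = n := by
    intro z _ n hn
    simp only [D, hn]
    rw [mul_div_cancel_right₀ _ (by simp [hpi])]
    simp
  have hmaps : MapsTo D S (range fun n : ℤ ↦ (n : ℝ)) := fun z hz ↦ by
    obtain ⟨n, hn⟩ := key z hz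
    exact ⟨n, (hDn z hz n hn).symm⟩
  have hxy := hS.constant_of_mapsTo hT hD hmaps hx hy
  have hy0 : D y = 0 := by simp [D]
  obtain ⟨n, hn⟩ := key x hx
  have : (n : ℝ) = 0 := by rw [← hDn x hx n hn, hxy, hy0]
  have hn0 : n = 0 := by exact_mod_cast this
  rw [hn0] at hn
  linear_combination (norm := (push_cast; ring)) hn

/-- A nonempty closed subset of a proper space has points nearest to a given point. -/
theorem IsClosed.exists_dist_eq_infDist {X : Type*} [MetricSpace X] [ProperSpace X] {S : Set X}
    (hS : IsClosed S) (hne : S.Nonempty) (x : X) : ∃ a ∈ S, dist x a = infDist x S := by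
  obtain ⟨a, ha, h⟩ := hS.exists_infDist_eq_dist hne x
  exact ⟨a, ha, h.symm⟩

section NormedSpace

variable {V : Type*} [NormedAddCommGroup V] [NormedSpace ℝ V]

/-- The set of points at least as close to the connected set `A` as to the set `B` is connected. -/
theorem isPreconnected_infDist_le [ProperSpace V] {A B : Set V} (hA : IsClosed A)
    (hAc : IsConnected A) : IsPreconnected {x | infDist x A ≤ infDist x B} := by
  have hsub : A ⊆ {x | infDist x A ≤ infDist x B} := fun x hx ↦ by
    simp only [mem_ofPred_eq, infDist_zero_of_mem hx]
    exact infDist_nonneg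
  obtain ⟨a₀, ha₀⟩ := hAc.nonempty
  refine isPreconnected_of_forall a₀ fun x hx ↦ ?_
  obtain ⟨a, ha, hxa⟩ := hA.exists_dist_eq_infDist ⟨a₀, ha₀⟩ x
  refine ⟨A ∪ segment ℝ a x, union_subset hsub ?_, .inl ha₀, .inr (right_mem_segment ℝ a x),
    hAc.isPreconnected.union a ha (left_mem_segment ℝ a x) (convex_segment a x).isPreconnected⟩
  intro y hy
  have h1 := dist_add_dist_of_mem_segment hy
  have h2 := infDist_le_dist_of_mem (x := y) ha
  have h3 := infDist_le_infDist_add_dist (s := B) (x := x) (y := y)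
  have hx' : infDist x A ≤ infDist x B := hx
  have h4 := dist_comm a y
  have h5 := dist_comm a x
  have h6 := dist_comm x y
  show infDist y A ≤ infDist y B
  linarith

/-- The equidistant set of two closed connected subsets of a proper normed space is connected. -/
theorem isConnected_equidistantSet [ProperSpace V] {A B : Set V} (hA : IsClosed A)
    (hB : IsClosed B) (hAc : IsConnected A) (hBc : IsConnected B) :
    IsConnected (equidistantSet A B) := by
  have hcA : Continuous fun x : V ↦ infDist x A := continuous_infDist_pt A
  have hcB : Continuous fun x : V ↦ infDist x B := continuous_infDist_pt B
  have hE : IsClosed (equidistantSet A B) := isClosed_eq hcA hcB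
  constructor
  · obtain ⟨a, ha⟩ := hAc.nonempty
    obtain ⟨b, hb⟩ := hBc.nonempty
    have ha' : infDist a A ≤ infDist a B := by
      rw [infDist_zero_of_mem ha]; exact infDist_nonneg
    have hb' : infDist b B ≤ infDist b A := by
      rw [infDist_zero_of_mem hb]; exact infDist_nonneg
    obtain ⟨x, -, hx⟩ := (isPreconnected_univ (α := V)).intermediate_value₂ (mem_univ a)
      (mem_univ b) hcA.continuousOn hcB.continuousOn ha' hb'
    exact ⟨x, hx⟩
  rw [isPreconnected_closed_iff]
  rintro t t' ht ht' hsub ⟨p, hpE, hpt⟩ ⟨q, hqE, hqt⟩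
  by_contra hne
  have hdisj : Disjoint (equidistantSet A B ∩ t) (equidistantSet A B ∩ t') :=
    Set.disjoint_left.2 fun x hx hx' ↦ hne ⟨x, hx.1, hx.2, hx'.2⟩
  obtain ⟨u, hu0, hu1, -⟩ := exists_continuous_zero_one_of_isClosed (hE.inter ht)
    (hE.inter ht') hdisj
  have hcu : Continuous fun x ↦ (u x : ℂ) := Complex.continuous_ofReal.comp u.continuous
  let f : V → ℂ := fun x ↦ if infDist x A ≤ infDist x B then
    Complex.exp (Real.pi * Complex.I * u x) else Complex.exp (-(Real.pi * Complex.I) * u x)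
  have hfeq : ∀ x, infDist x A = infDist x B →
      Complex.exp (Real.pi * Complex.I * u x) = Complex.exp (-(Real.pi * Complex.I) * u x) := by
    intro x hx
    rcases hsub (show x ∈ equidistantSet A B from hx) with h | h
    · rw [show u x = 0 from hu0 ⟨hx, h⟩]; simp
    · rw [show u x = 1 from hu1 ⟨hx, h⟩]; simp [Complex.exp_neg, Complex.exp_pi_mul_I]
  have hf : Continuous f := by
    refine Continuous.if_le ?_ ?_ hcA hcB hfeq <;> fun_prop
  have hsc : IsSimplyConnected (univ : Set V) :=
    have := (convex_univ (𝕜 := ℝ) (E := V)).contractibleSpace univ_nonempty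
    SimplyConnectedSpace.ofContractible _
  obtain ⟨φ, hφ, hφf⟩ := Complex.exists_continuousOn_eqOn_exp_comp (U := (univ : Set V))
    (g := f) hsc isOpen_univ hf.continuousOn (by
      rintro ⟨x, -, hx⟩
      simp only [f] at hx
      split_ifs at hx <;> exact Complex.exp_ne_zero _ hx)
  have h1 := (isPreconnected_infDist_le (B := B) hA hAc).sub_eq_sub_of_exp_eq_mul_exp (k := 1)
    (F := φ) (G := fun x ↦ Real.pi * Complex.I * u x) (hφ.mono (subset_univ _))
    (by fun_prop) (fun z hz ↦ by
      have := hφf (mem_univ z)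
      simp only [Function.comp_apply, f] at this
      rw [this, one_mul, if_pos (by exact hz)]) hpE.le hqE.le
  have h2 := (isPreconnected_infDist_le (B := A) hB hBc).sub_eq_sub_of_exp_eq_mul_exp (k := 1)
    (F := φ) (G := fun x ↦ -(Real.pi * Complex.I) * u x) (hφ.mono (subset_univ _))
    (by fun_prop) (fun z hz ↦ by
      have := hφf (mem_univ z)
      simp only [Function.comp_apply, f] at this
      rw [this, one_mul]
      split_ifs with hle
      · exact hfeq z (le_antisymm hle hz)
      · rfl) hpE.ge hqE.ge
  rw [h1] at h2
  simp only [show u p = 0 from hu0 ⟨hpE, hpt⟩, show u q = 1 from hu1 ⟨hqE, hqt⟩] at h2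
  have := congrArg Complex.im h2
  simp at this
  linarith [Real.pi_pos]

end NormedSpace

/-- The ratio `(z - b₁) / (z - b₂)` has a continuous logarithm on a closed set `K` when `b₁` and
`b₂` lie in a connected set avoiding `K`. -/
theorem exists_continuousOn_log_div {K B : Set ℂ} (hK : IsClosed K) (hKne : K.Nonempty)
    (hB : IsPreconnected B) (hKB : Disjoint K B) {b₁ b₂ : ℂ} (hb₁ : b₁ ∈ B) (hb₂ : b₂ ∈ B) :
    ∃ L : ℂ → ℂ, ContinuousOn L K ∧ ∀ z ∈ K, Complex.exp (L z) = (z - b₁) / (z - b₂) := by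
  let P : ℂ → Prop := fun c ↦
    ∃ L : ℂ → ℂ, ContinuousOn L K ∧ ∀ z ∈ K, Complex.exp (L z) = (z - c) / (z - b₂)
  have near : ∀ c ∉ K, ∀ c' ∈ ball c (infDist c K), c' ∉ K ∧
      ∃ M : ℂ → ℂ, ContinuousOn M K ∧ ∀ z ∈ K, Complex.exp (M z) = (z - c') / (z - c) := by
    intro c hc c' hc'
    have hc'K : c' ∉ K := fun h ↦ by
      have := infDist_le_dist_of_mem (x := c) h
      rw [mem_ball, dist_comm] at hc'
      linarith
    have hne : ∀ z ∈ K, z - c ≠ 0 := fun z hz h ↦ hc (sub_eq_zero.1 h ▸ hz)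
    have hne' : ∀ z ∈ K, z - c' ≠ 0 := fun z hz h ↦ hc'K (sub_eq_zero.1 h ▸ hz)
    refine ⟨hc'K, fun z ↦ Complex.log ((z - c') / (z - c)), ?_, fun z hz ↦
      Complex.exp_log (div_ne_zero (hne' z hz) (hne z hz))⟩
    refine ContinuousOn.clog (ContinuousOn.div (by fun_prop) (by fun_prop) hne) fun z hz ↦ ?_
    have heq : (z - c') / (z - c) = 1 + (c - c') / (z - c) := by
      field_simp [hne z hz]; ring
    rw [heq]
    refine Complex.mem_slitPlane_of_norm_lt_one ?_
    rw [norm_div, div_lt_one (norm_pos_iff.2 (hne z hz))]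
    have h1 := infDist_le_dist_of_mem (x := c) hz
    rw [mem_ball, dist_comm, dist_eq_norm] at hc'
    rw [dist_comm, dist_eq_norm] at h1
    linarith
  have hball : ∀ c ∉ K, ball c (infDist c K) ∈ nhds c := fun c hc ↦
    ball_mem_nhds c ((hK.notMem_iff_infDist_pos hKne).1 hc)
  have hP : IsOpen {c | c ∉ K ∧ P c} := isOpen_iff_mem_nhds.2 fun c ⟨hc, L, hL, hLe⟩ ↦ by
    filter_upwards [hball c hc] with c' hc'
    obtain ⟨hc'K, M, hM, hMe⟩ := near c hc c' hc'
    refine ⟨hc'K, fun z ↦ M z + L z, hM.add hL, fun z hz ↦ ?_⟩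
    rw [Complex.exp_add, hMe z hz, hLe z hz, div_mul_div_cancel₀]
    exact fun h ↦ hc (sub_eq_zero.1 h ▸ hz)
  have hP' : IsOpen {c | c ∉ K ∧ ¬ P c} := isOpen_iff_mem_nhds.2 fun c ⟨hc, hnot⟩ ↦ by
    filter_upwards [hball c hc] with c' hc'
    obtain ⟨hc'K, M, hM, hMe⟩ := near c hc c' hc'
    refine ⟨hc'K, fun ⟨L, hL, hLe⟩ ↦ hnot ⟨fun z ↦ L z - M z, hL.sub hM, fun z hz ↦ ?_⟩⟩
    rw [Complex.exp_sub, hMe z hz, hLe z hz]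
    have : z - c' ≠ 0 := fun h ↦ hc'K (sub_eq_zero.1 h ▸ hz)
    rw [div_div_div_eq, mul_comm (z - b₂), mul_div_mul_left _ _ this]
  have hBK : ∀ c ∈ B, c ∉ K := fun c hc h ↦ Set.disjoint_left.1 hKB h hc
  have hsub := hB.subset_left_of_subset_union hP hP'
    (Set.disjoint_left.2 fun c h h' ↦ h'.2 h.2)
    (fun c hc ↦ by by_cases h : P c <;> [left; right] <;> exact ⟨hBK c hc, h⟩)
    ⟨b₂, hb₂, hBK b₂ hb₂, fun _ ↦ 0, continuousOn_const, fun z hz ↦ by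
      have : z - b₂ ≠ 0 := fun h ↦ hBK b₂ hb₂ (sub_eq_zero.1 h ▸ hz)
      rw [div_self this, Complex.exp_zero]⟩
  exact (hsub hb₁).2

theorem re_sq_add_im_sq_of_norm_eq_one {z : ℂ} (hz : ‖z‖ = 1) : z.re ^ 2 + z.im ^ 2 = 1 := by
  have := Complex.sq_norm z
  rw [hz, Complex.normSq_apply] at this
  linarith

/-- Disjoint connected sets outside the open unit disc do not interleave on the unit circle:
points of `A` on the circle lie on the same side of a chord joining two points of `B`. -/
theorem same_side_of_chord {A B : Set ℂ} (hA : IsClosed A) (hAc : IsPreconnected A)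
    (hBc : IsPreconnected B) (hAB : Disjoint A B) (hA1 : ∀ a ∈ A, 1 ≤ ‖a‖) (hB1 : ∀ b ∈ B, 1 ≤ ‖b‖)
    {a₁ a₂ b₁ b₂ : ℂ} (ha₁ : a₁ ∈ A) (ha₂ : a₂ ∈ A) (hb₁ : b₁ ∈ B) (hb₂ : b₂ ∈ B)
    (na₁ : ‖a₁‖ = 1) (na₂ : ‖a₂‖ = 1) (nb₁ : ‖b₁‖ = 1) (nb₂ : ‖b₂‖ = 1)
    (hpos : 0 < ((a₁ - b₁) * (starRingEnd ℂ) (b₂ - b₁)).im) :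
    0 < ((a₂ - b₁) * (starRingEnd ℂ) (b₂ - b₁)).im := by
  by_contra! hneg
  have ha12 : a₁ ≠ a₂ := by rintro rfl; linarith
  have hb12 : b₁ ≠ b₂ := by rintro rfl; simp at hpos
  set Q := segment ℝ a₁ a₂ with hQ
  have hQ1 : ∀ z ∈ Q, ‖z‖ ≤ 1 := fun z hz ↦ by
    have := (convex_closedBall (0 : ℂ) 1).segment_subset (x := a₁) (y := a₂)
      (by simp [na₁]) (by simp [na₂]) hz
    simpa using this
  have hQB : ∀ z ∈ Q, z ∉ B := fun z hz hzB ↦ by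
    rw [hQ, ← insert_endpoints_openSegment] at hz
    rcases hz with rfl | rfl | hz
    · exact Set.disjoint_left.1 hAB ha₁ hzB
    · exact Set.disjoint_left.1 hAB ha₂ hzB
    · have := openSegment_subset_ball_of_ne (z := (0 : ℂ)) (r := 1) (by simp [na₁])
        (by simp [na₂]) ha12 hz
      have h2 := hB1 z hzB
      simp at this
      linarith
  have hKB : Disjoint (A ∪ Q) B := Set.disjoint_left.2 fun z hz hzB ↦
    hz.elim (fun h ↦ Set.disjoint_left.1 hAB h hzB) fun h ↦ hQB z h hzB
  have hQcl : IsClosed Q := by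
    rw [hQ, ← convexHull_pair]
    exact ((Set.toFinite {a₁, a₂}).isCompact_convexHull (𝕜 := ℝ)).isClosed
  obtain ⟨L, hL, hLe⟩ := exists_continuousOn_log_div (hA.union hQcl) ⟨a₁, .inl ha₁⟩ hBc hKB hb₁ hb₂
  set κ : ℂ := Complex.I * (b₂ * (starRingEnd ℂ) b₁ - 1) with hκ
  let v : ℂ → ℂ := fun z ↦ κ * ((z - b₁) / (z - b₂))
  have sb₁ := re_sq_add_im_sq_of_norm_eq_one nb₁
  have sb₂ := re_sq_add_im_sq_of_norm_eq_one nb₂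
  set C : ℝ := b₁.re * b₂.re + b₁.im * b₂.im with hC
  have hCpos : 0 < 1 - C := by
    have h : 0 < (b₁.re - b₂.re) ^ 2 + (b₁.im - b₂.im) ^ 2 := by
      have := Complex.normSq_pos.2 (sub_ne_zero.2 hb12)
      rw [Complex.normSq_apply] at this
      simp only [Complex.sub_re, Complex.sub_im] at this
      nlinarith
    nlinarith
  have hκ0 : κ ≠ 0 := fun h ↦ by
    have := congrArg Complex.im h
    simp [hκ] at this
    linarith
  have vne : ∀ z ∈ A ∪ Q, v z ≠ 0 := fun z hz ↦ by
    have := Complex.exp_ne_zero (L z)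
    rw [hLe z hz] at this
    exact mul_ne_zero hκ0 this
  have hv : ∀ z, v z = (κ * ((z - b₁) * (starRingEnd ℂ) (z - b₂))) *
      ((Complex.normSq (z - b₂))⁻¹ : ℝ) := fun z ↦ by
    simp only [v, div_eq_mul_inv, Complex.inv_def]; ring
  have vim : ∀ z, (v z).im = (1 - C) * (1 - ‖z‖ ^ 2) * (Complex.normSq (z - b₂))⁻¹ := fun z ↦ by
    rw [hv, Complex.im_mul_ofReal, Complex.sq_norm, Complex.normSq_apply z, hκ]
    congr 1
    simp only [Complex.mul_im, Complex.mul_re, Complex.I_re, Complex.I_im, Complex.sub_re,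
      Complex.sub_im, Complex.one_re, Complex.one_im, Complex.conj_re, Complex.conj_im, hC]
    grind
  have vre : ∀ z, ‖z‖ = 1 → (v z).re =
      -2 * ((z - b₁) * (starRingEnd ℂ) (b₂ - b₁)).im * (Complex.normSq (z - b₂))⁻¹ := fun z hz ↦ by
    have sz := re_sq_add_im_sq_of_norm_eq_one hz
    rw [hv, Complex.re_mul_ofReal, hκ]
    congr 1
    simp only [Complex.mul_im, Complex.mul_re, Complex.I_re, Complex.I_im, Complex.sub_re,
      Complex.sub_im, Complex.one_re, Complex.one_im, Complex.conj_re, Complex.conj_im]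
    grind
  have hAim : ∀ z ∈ A, (v z).im ≤ 0 := fun z hz ↦ by
    rw [vim]
    have := hA1 z hz
    exact mul_nonpos_of_nonpos_of_nonneg
      (mul_nonpos_of_nonneg_of_nonpos hCpos.le (by nlinarith))
      (inv_nonneg.2 (Complex.normSq_nonneg _))
  have hQim : ∀ z ∈ Q, 0 ≤ (v z).im := fun z hz ↦ by
    rw [vim]
    have := hQ1 z hz
    have h0 := norm_nonneg z
    exact mul_nonneg (mul_nonneg hCpos.le (by nlinarith)) (inv_nonneg.2 (Complex.normSq_nonneg _))
  have hvc : ContinuousOn v (A ∪ Q) := by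
    refine ContinuousOn.mul continuousOn_const (ContinuousOn.div (by fun_prop) (by fun_prop) ?_)
    exact fun z hz h ↦ Set.disjoint_left.1 hKB hz (sub_eq_zero.1 h ▸ hb₂)
  have slit : ∀ {w : ℂ}, w ≠ 0 → 0 ≤ w.re → w ∈ Complex.slitPlane := fun {w} hw hre ↦ by
    rw [Complex.mem_slitPlane_iff]
    rcases hre.lt_or_eq with h | h
    · exact .inl h
    · exact .inr fun him ↦ hw (Complex.ext h.symm him)
  have diff : ∀ (S : Set ℂ) (j : ℂ), S ⊆ A ∪ Q → IsPreconnected S → a₁ ∈ S → a₂ ∈ S → j ≠ 0 →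
      (∀ z ∈ S, 0 ≤ (j * v z).re) →
      L a₁ - L a₂ = Complex.log (j * v a₁) - Complex.log (j * v a₂) := by
    intro S j hS hSc h₁ h₂ hj hre
    refine hSc.sub_eq_sub_of_exp_eq_mul_exp (G := fun z ↦ Complex.log (j * v z)) (k := (j * κ)⁻¹)
      (hL.mono hS) ((continuousOn_const.mul (hvc.mono hS)).clog fun z hz ↦
        slit (mul_ne_zero hj (vne z (hS hz))) (hre z hz)) (fun z hz ↦ ?_) h₁ h₂
    rw [Complex.exp_log (mul_ne_zero hj (vne z (hS hz))), hLe z (hS hz)]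
    simp only [v]
    field_simp
  have dA := diff A Complex.I subset_union_left hAc ha₁ ha₂ Complex.I_ne_zero fun z hz ↦ by
    simpa using hAim z hz
  have dQ := diff Q (-Complex.I) subset_union_right (convex_segment a₁ a₂).isPreconnected
    (left_mem_segment ℝ a₁ a₂) (right_mem_segment ℝ a₁ a₂) (neg_ne_zero.2 Complex.I_ne_zero)
    fun z hz ↦ by simpa using hQim z hz
  have v_eq_re : ∀ a, ‖a‖ = 1 → v a = ((v a).re : ℂ) := fun a ha ↦
    Complex.ext rfl (by rw [vim, ha]; simp)
  have hnpos : ∀ a ∈ A, 0 < (Complex.normSq (a - b₂))⁻¹ := fun a ha ↦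
    inv_pos.2 <| Complex.normSq_pos.2 <| sub_ne_zero.2 <| by
      rintro rfl; exact Set.disjoint_left.1 hAB ha hb₂
  have r₁ : (v a₁).re < 0 := by
    rw [vre a₁ na₁]
    have := hnpos a₁ ha₁
    nlinarith [mul_pos hpos this]
  have r₂ : 0 < (v a₂).re := by
    refine lt_of_le_of_ne ?_ fun h ↦ vne a₂ (.inl ha₂) (by rw [v_eq_re a₂ na₂, ← h]; rfl)
    rw [vre a₂ na₂]
    exact mul_nonneg (by linarith) (hnpos a₂ ha₂).le
  rw [dA] at dQ
  have him := congrArg Complex.im dQ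
  simp only [Complex.sub_im, Complex.log_im] at him
  have e₁ : Complex.I * ((v a₁).re : ℂ) = ((-(v a₁).re : ℝ) : ℂ) * -Complex.I := by
    push_cast; ring
  have e₂ : -Complex.I * ((v a₁).re : ℂ) = ((-(v a₁).re : ℝ) : ℂ) * Complex.I := by
    push_cast; ring
  rw [v_eq_re a₁ na₁, v_eq_re a₂ na₂, e₁, e₂, mul_comm Complex.I,
    mul_comm (-Complex.I) ((v a₂).re : ℂ),
    Complex.arg_real_mul _ (neg_pos.2 r₁), Complex.arg_real_mul _ (neg_pos.2 r₁),
    Complex.arg_real_mul _ r₂, Complex.arg_real_mul _ r₂, Complex.arg_I, Complex.arg_neg_I] at him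
  linarith [Real.pi_pos]

theorem one_add_re_ne_zero {z : ℂ} (hz : ‖z‖ = 1) (hz' : z ≠ -1) : 1 + z.re ≠ 0 := fun h ↦ hz' <| by
  have sz := re_sq_add_im_sq_of_norm_eq_one hz
  have hre : z.re = -1 := by linarith
  have him : z.im = 0 := by
    rw [hre] at sz
    exact (pow_eq_zero_iff two_ne_zero).1 (by linarith)
  exact Complex.ext (by simpa using hre) (by simpa using him)

/-- Rational parametrization of the unit circle, with parameter the slope seen from `-1`. -/
theorem re_im_eq_of_norm_eq_one {z : ℂ} (hz : ‖z‖ = 1) (hz' : z ≠ -1) :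
    z.re = (1 - (z.im / (1 + z.re)) ^ 2) / (1 + (z.im / (1 + z.re)) ^ 2) ∧
      z.im = 2 * (z.im / (1 + z.re)) / (1 + (z.im / (1 + z.re)) ^ 2) := by
  have sz := re_sq_add_im_sq_of_norm_eq_one hz
  have h1 := one_add_re_ne_zero hz hz'
  have h2 : (1 + z.re) ^ 2 + z.im ^ 2 = 2 * (1 + z.re) := by linear_combination sz
  have h3 : 1 + (z.im / (1 + z.re)) ^ 2 = 2 / (1 + z.re) := by
    field_simp
    linear_combination h2
  rw [h3]
  constructor
  · field_simp
    linear_combination sz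
  · field_simp

/-- If two disjoint closed connected sets lie outside the open unit disc, their traces on the unit
circle are strictly separated by a line. -/
theorem exists_separating_direction {A B : Set ℂ} (hA : IsClosed A) (hB : IsClosed B)
    (hAc : IsPreconnected A) (hBc : IsPreconnected B) (hAB : Disjoint A B)
    (hA1 : ∀ a ∈ A, 1 ≤ ‖a‖) (hB1 : ∀ b ∈ B, 1 ≤ ‖b‖) (hmem : (-1 : ℂ) ∈ A)
    (hBne : ∃ b ∈ B, ‖b‖ = 1) :
    ∃ c : ℂ, c ≠ 0 ∧ ∀ a ∈ A, ‖a‖ = 1 → ∀ b ∈ B, ‖b‖ = 1 → (c * b).im < (c * a).im := by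
  have hAB' : ∀ z ∈ A, z ∉ B := fun z hz ↦ Set.disjoint_left.1 hAB hz
  set B₀ := B ∩ sphere 0 1 with hB₀
  have hB₀c : IsCompact B₀ := (isCompact_sphere 0 1).inter_left hB
  have hB₀ne : B₀.Nonempty := by
    obtain ⟨b, hb, hb1⟩ := hBne
    exact ⟨b, hb, by simpa using hb1⟩
  have hneg : ∀ b ∈ B, b ≠ -1 := fun b hb h ↦ hAB' _ hmem (h ▸ hb)
  have hnorm : ∀ b ∈ B₀, ‖b‖ = 1 := fun b hb ↦ by simpa using hb.2
  let t : ℂ → ℝ := fun b ↦ b.im / (1 + b.re)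
  have ht : ContinuousOn t B₀ := ContinuousOn.div Complex.continuous_im.continuousOn
    (by fun_prop)
    fun b hb ↦ one_add_re_ne_zero (hnorm b hb) (hneg b hb.1)
  obtain ⟨b₁, hb₁, hmin⟩ := hB₀c.exists_isMinOn hB₀ne ht
  obtain ⟨b₂, hb₂, hmax⟩ := hB₀c.exists_isMaxOn hB₀ne ht
  by_cases h12 : b₁ = b₂
  · have hall : ∀ b ∈ B₀, b = b₁ := fun b hb ↦ by
      have htb : t b = t b₁ := le_antisymm (h12 ▸ hmax hb) (hmin hb)
      obtain ⟨e1, e2⟩ := re_im_eq_of_norm_eq_one (hnorm b hb) (hneg b hb.1)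
      obtain ⟨e3, e4⟩ := re_im_eq_of_norm_eq_one (hnorm b₁ hb₁) (hneg b₁ hb₁.1)
      have htb' : b.im / (1 + b.re) = b₁.im / (1 + b₁.re) := htb
      rw [htb'] at e1 e2
      exact Complex.ext (e1.trans e3.symm) (e2.trans e4.symm)
    have hs₁ := re_sq_add_im_sq_of_norm_eq_one (hnorm b₁ hb₁)
    refine ⟨-Complex.I * (starRingEnd ℂ) b₁, ?_, fun a ha na b hb nb ↦ ?_⟩
    · refine mul_ne_zero (neg_ne_zero.2 Complex.I_ne_zero) fun h ↦ ?_
      rw [map_eq_zero] at h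
      rw [h] at hs₁
      norm_num at hs₁
    · rw [hall b ⟨hb, by simpa using nb⟩]
      have hsa := re_sq_add_im_sq_of_norm_eq_one na
      have hne : a ≠ b₁ := fun h ↦ hAB' a ha (h ▸ hb₁.1)
      have hpos : 0 < (a.re - b₁.re) ^ 2 + (a.im - b₁.im) ^ 2 := by
        have := Complex.normSq_pos.2 (sub_ne_zero.2 hne)
        rw [Complex.normSq_apply] at this
        simp only [Complex.sub_re, Complex.sub_im] at this
        nlinarith
      simp
      nlinarith
  · obtain ⟨x1, y1⟩ := re_im_eq_of_norm_eq_one (hnorm b₁ hb₁) (hneg b₁ hb₁.1)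
    obtain ⟨x2, y2⟩ := re_im_eq_of_norm_eq_one (hnorm b₂ hb₂) (hneg b₂ hb₂.1)
    have hlt : t b₁ < t b₂ := by
      refine lt_of_le_of_ne (hmax hb₁) fun h ↦ h12 ?_
      have h' : b₁.im / (1 + b₁.re) = b₂.im / (1 + b₂.re) := h
      rw [h'] at x1 y1
      exact Complex.ext (x1.trans x2.symm) (y1.trans y2.symm)
    change b₁.re = (1 - t b₁ ^ 2) / (1 + t b₁ ^ 2) at x1
    change b₂.re = (1 - t b₂ ^ 2) / (1 + t b₂ ^ 2) at x2
    change b₁.im = 2 * t b₁ / (1 + t b₁ ^ 2) at y1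
    change b₂.im = 2 * t b₂ / (1 + t b₂ ^ 2) at y2
    have hside : 0 < ((-1 - b₁) * (starRingEnd ℂ) (b₂ - b₁)).im := by
      have : ((-1 - b₁) * (starRingEnd ℂ) (b₂ - b₁)).im =
          4 * (t b₂ - t b₁) / ((1 + t b₁ ^ 2) * (1 + t b₂ ^ 2)) := by
        simp only [Complex.mul_im, Complex.conj_re, Complex.conj_im, Complex.sub_re, Complex.sub_im,
          Complex.neg_re, Complex.neg_im, Complex.one_re, Complex.one_im]
        rw [x1, x2, y1, y2]
        field_simp
        ring
      rw [this]
      have := sub_pos.2 hlt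
      positivity
    refine ⟨(starRingEnd ℂ) (b₂ - b₁), ?_, fun a ha na b hb nb ↦ ?_⟩
    · rw [Ne, map_eq_zero, sub_eq_zero]
      exact fun h ↦ h12 h.symm
    · have hsa := same_side_of_chord hA hAc hBc hAB hA1 hB1 hmem ha hb₁.1 hb₂.1 (by simp) na
        (hnorm b₁ hb₁) (hnorm b₂ hb₂) hside
      have hb₀ : b ∈ B₀ := ⟨hb, by simpa using nb⟩
      obtain ⟨x, y⟩ := re_im_eq_of_norm_eq_one nb (hneg b hb)
      change b.re = (1 - t b ^ 2) / (1 + t b ^ 2) at x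
      change b.im = 2 * t b / (1 + t b ^ 2) at y
      have hsb : ((b - b₁) * (starRingEnd ℂ) (b₂ - b₁)).im ≤ 0 := by
        have : ((b - b₁) * (starRingEnd ℂ) (b₂ - b₁)).im =
            4 * ((t b - t b₁) * (t b₂ - t b₁)) * (t b - t b₂) /
              ((1 + t b ^ 2) * (1 + t b₁ ^ 2) * (1 + t b₂ ^ 2)) := by
          simp only [Complex.mul_im, Complex.conj_re, Complex.conj_im, Complex.sub_re,
            Complex.sub_im]
          rw [x1, x2, y1, y2, x, y]
          field_simp
          ring
        rw [this]
        refine div_nonpos_of_nonpos_of_nonneg (mul_nonpos_of_nonneg_of_nonpos ?_ ?_) (by positivity)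
        · have h1 : t b₁ ≤ t b := hmin hb₀
          exact mul_nonneg (by norm_num) (mul_nonneg (by linarith) (by linarith))
        · have h1 : t b ≤ t b₂ := hmax hb₀
          linarith
      rw [mul_comm, mul_sub, Complex.sub_im] at hsa hsb
      linarith

/-- If the points of `A` of norm `r` lie above those of `B`, then so do the points of norm at most
`r + δ` for some `δ > 0`. -/
theorem exists_pos_im_lt_im {A B : Set ℂ} (hA : IsClosed A) (hB : IsClosed B) {r : ℝ}
    (hAr : ∀ a ∈ A, r ≤ ‖a‖) (hBr : ∀ b ∈ B, r ≤ ‖b‖)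
    (h : ∀ a ∈ A, ‖a‖ = r → ∀ b ∈ B, ‖b‖ = r → b.im < a.im) :
    ∃ δ > 0, ∀ a ∈ A, ‖a‖ ≤ r + δ → ∀ b ∈ B, ‖b‖ ≤ r + δ → b.im < a.im := by
  let K : Set (ℂ × ℂ) := (A ∩ closedBall 0 (r + 1)) ×ˢ (B ∩ closedBall 0 (r + 1)) ∩
    {p | p.1.im ≤ p.2.im}
  have hK : IsCompact K :=
    (((isCompact_closedBall 0 (r + 1)).inter_left hA).prod
      ((isCompact_closedBall 0 (r + 1)).inter_left hB)).inter_right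
      (isClosed_le (by fun_prop) (by fun_prop))
  have hmem : ∀ δ ≤ 1, ∀ a ∈ A, ‖a‖ ≤ r + δ → ∀ b ∈ B, ‖b‖ ≤ r + δ → a.im ≤ b.im → (a, b) ∈ K :=
    fun δ hδ a ha na b hb nb hab ↦
      ⟨⟨⟨ha, by simp; linarith⟩, ⟨hb, by simp; linarith⟩⟩, hab⟩
  rcases K.eq_empty_or_nonempty with hne | hne
  · refine ⟨1, one_pos, fun a ha na b hb nb ↦ not_le.1 fun hab ↦ ?_⟩
    exact (hne ▸ hmem 1 le_rfl a ha na b hb nb hab : (a, b) ∈ (∅ : Set (ℂ × ℂ)))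
  obtain ⟨⟨a₀, b₀⟩, hK₀, hmin⟩ := hK.exists_isMinOn hne
    (f := fun p ↦ max ‖p.1‖ ‖p.2‖) (by fun_prop)
  have hr : r < max ‖a₀‖ ‖b₀‖ := by
    by_contra! hle
    obtain ⟨ha, hb⟩ := max_le_iff.1 hle
    exact (h a₀ hK₀.1.1.1 (le_antisymm ha (hAr _ hK₀.1.1.1)) b₀ hK₀.1.2.1
      (le_antisymm hb (hBr _ hK₀.1.2.1))).not_ge hK₀.2
  refine ⟨min 1 ((max ‖a₀‖ ‖b₀‖ - r) / 2), lt_min one_pos (by linarith),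
    fun a ha na b hb nb ↦ not_le.1 fun hab ↦ ?_⟩
  have h1 : max ‖a₀‖ ‖b₀‖ ≤ max ‖a‖ ‖b‖ :=
    hmin (hmem _ (min_le_left _ _) a ha na b hb nb hab)
  have h2 := min_le_right 1 ((max ‖a₀‖ ‖b₀‖ - r) / 2)
  have h3 := max_le na nb
  linarith

/-- The part of the zero set of `f` in an open rectangle is homeomorphic to `ℝ` when `f` is
strictly decreasing through zero along vertical lines. -/
theorem nonempty_homeomorph_of_vertical_monotone {f : ℂ → ℝ} (hf : Continuous f) {ε η : ℝ}
    (hε : 0 < ε) (hη : 0 < η)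
    (hmono : ∀ x y y' : ℝ, |x| < ε → |y| ≤ η → |y'| ≤ η → y < y' → 0 ≤ f ⟨x, y'⟩ → 0 < f ⟨x, y⟩)
    (htop : ∀ x : ℝ, |x| < ε → f ⟨x, η⟩ < 0) (hbot : ∀ x : ℝ, |x| < ε → 0 < f ⟨x, -η⟩) :
    Nonempty (({z : ℂ | |z.re| < ε ∧ |z.im| < η} ∩ {z | f z = 0} : Set ℂ) ≃ₜ ℝ) := by
  have hline : ∀ x : ℝ, Continuous fun y : ℝ ↦ f ⟨x, y⟩ := fun x ↦
    hf.comp (Complex.equivRealProdCLM.symm.continuous.comp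
      (by fun_prop : Continuous fun y : ℝ ↦ (x, y)))
  have hline' : ∀ y : ℝ, Continuous fun x : ℝ ↦ f ⟨x, y⟩ := fun y ↦
    hf.comp (Complex.equivRealProdCLM.symm.continuous.comp
      (by fun_prop : Continuous fun x : ℝ ↦ (x, y)))
  have hex : ∀ x : ℝ, ∃ y : ℝ, |x| < ε → |y| < η ∧ f ⟨x, y⟩ = 0 := by
    intro x
    by_cases hx : |x| < ε
    · obtain ⟨y, hy, hy0⟩ := intermediate_value_Ioo' (by linarith : -η ≤ η)
        (hline x).continuousOn (show (0 : ℝ) ∈ Ioo _ _ from ⟨htop x hx, hbot x hx⟩)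
      exact ⟨y, fun _ ↦ ⟨abs_lt.2 hy, hy0⟩⟩
    · exact ⟨0, fun h ↦ absurd h hx⟩
  choose g hg using hex
  have hpos : ∀ x y : ℝ, |x| < ε → |y| ≤ η → y < g x → 0 < f ⟨x, y⟩ := fun x y hx hy hlt ↦
    hmono x y (g x) hx hy (hg x hx).1.le hlt (hg x hx).2.ge
  have hneg : ∀ x y : ℝ, |x| < ε → |y| ≤ η → g x < y → f ⟨x, y⟩ < 0 := fun x y hx hy hlt ↦
    not_le.1 fun h ↦ (hmono x (g x) y hx (hg x hx).1.le hy hlt h).ne' (hg x hx).2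
  have hgc : ContinuousOn g {x | |x| < ε} := by
    have hopen : IsOpen {x : ℝ | |x| < ε} := isOpen_lt continuous_abs continuous_const
    intro x₀ hx₀
    have hx₀' : |x₀| < ε := hx₀
    refine ContinuousAt.continuousWithinAt (tendsto_order.2 ⟨fun c hc ↦ ?_, fun c hc ↦ ?_⟩)
    · by_cases hcη : -η ≤ c
      · have hcabs : |c| ≤ η := abs_le.2 ⟨hcη, hc.le.trans (abs_lt.1 (hg x₀ hx₀').1).2.le⟩
        filter_upwards [hopen.mem_nhds hx₀,
          (hline' c).continuousAt.eventually_const_lt (hpos x₀ c hx₀' hcabs hc)] with x hx hfx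
        by_contra! hle
        rcases hle.lt_or_eq with hlt | heq
        · exact (hneg x c hx hcabs hlt).not_gt hfx
        · exact hfx.ne' (heq ▸ (hg x hx).2)
      · filter_upwards [hopen.mem_nhds hx₀] with x hx
        have := (abs_lt.1 (hg x hx).1).1
        linarith
    · by_cases hcη : c ≤ η
      · have hcabs : |c| ≤ η := abs_le.2 ⟨(abs_lt.1 (hg x₀ hx₀').1).1.le.trans hc.le, hcη⟩
        filter_upwards [hopen.mem_nhds hx₀,
          (hline' c).continuousAt.eventually_lt_const (hneg x₀ c hx₀' hcabs hc)] with x hx hfx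
        by_contra! hle
        rcases hle.lt_or_eq with hlt | heq
        · exact (hpos x c hx hcabs hlt).not_gt hfx
        · exact hfx.ne (heq ▸ (hg x hx).2)
      · filter_upwards [hopen.mem_nhds hx₀] with x hx
        have := (abs_lt.1 (hg x hx).1).2
        linarith
  have huniq : ∀ z : ℂ, |z.re| < ε → |z.im| < η → f z = 0 → g z.re = z.im := by
    intro z hre him hz
    rcases lt_trichotomy (g z.re) z.im with h | h | h
    · exact absurd hz (hneg z.re z.im hre him.le h).ne
    · exact h
    · exact absurd hz (hpos z.re z.im hre him.le h).ne'
  have hball : ball (0 : ℝ) ε = {x | |x| < ε} := by ext; simp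
  let e₁ : ({z : ℂ | |z.re| < ε ∧ |z.im| < η} ∩ {z | f z = 0} : Set ℂ) ≃ₜ {x : ℝ | |x| < ε} :=
    { toFun := fun z ↦ ⟨z.1.re, z.2.1.1⟩
      invFun := fun x ↦ ⟨⟨x.1, g x.1⟩, ⟨x.2, (hg x.1 x.2).1⟩, (hg x.1 x.2).2⟩
      left_inv := fun z ↦ Subtype.ext (Complex.ext rfl (huniq z.1 z.2.1.1 z.2.1.2 z.2.2))
      right_inv := fun x ↦ rfl
      continuous_toFun := by fun_prop
      continuous_invFun := by
        refine Continuous.subtype_mk (Complex.equivRealProdCLM.symm.continuous.comp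
          (continuous_subtype_val.prodMk ?_)) _
        exact continuousOn_iff_continuous_domRestrict.1 hgc }
  let e₂ : ball (0 : ℝ) ε ≃ₜ ℝ :=
    ((Homeomorph.setCongr (OpenPartialHomeomorph.univBall_target (0 : ℝ) hε).symm).trans
      (OpenPartialHomeomorph.univBall (0 : ℝ) ε).toHomeomorphSourceTarget.symm).trans
      ((Homeomorph.setCongr (OpenPartialHomeomorph.univBall_source (0 : ℝ) ε)).trans
        (Homeomorph.Set.univ ℝ))
  exact ⟨(e₁.trans (Homeomorph.setCongr hball.symm)).trans e₂⟩

/-- If the points of `A` nearest to `0` lie above those of `B`, then the equidistant set is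
a graph over the horizontal axis near `0`. -/
theorem exists_chart_at_zero {A B : Set ℂ} (hA : IsClosed A) (hB : IsClosed B) (hAne : A.Nonempty)
    (hBne : B.Nonempty) (h0 : infDist 0 A = infDist 0 B)
    (h : ∀ a ∈ A, ‖a‖ = infDist 0 A → ∀ b ∈ B, ‖b‖ = infDist 0 A → b.im < a.im) :
    ∃ U : Set ℂ, IsOpen U ∧ 0 ∈ U ∧ Nonempty ((U ∩ equidistantSet A B : Set ℂ) ≃ₜ ℝ) := by
  set r := infDist 0 A with hr
  obtain ⟨δ, hδ, hsep⟩ := exists_pos_im_lt_im hA hB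
    (fun a ha ↦ by simpa using infDist_le_dist_of_mem (x := 0) ha)
    (fun b hb ↦ by rw [h0]; simpa using infDist_le_dist_of_mem (x := 0) hb) h
  let f : ℂ → ℝ := fun z ↦ infDist z A - infDist z B
  have hf : Continuous f := (continuous_infDist_pt A).sub (continuous_infDist_pt B)
  have hf0 : f 0 = 0 := sub_eq_zero.2 h0
  have hnear : ∀ {S : Set ℂ}, infDist 0 S = r → ∀ z s : ℂ, ‖z‖ ≤ δ / 2 → dist z s = infDist z S →
      ‖s‖ ≤ r + δ := by
    intro S hS z s hz hs
    have h1 := infDist_le_infDist_add_dist (s := S) (x := z) (y := 0)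
    have h2 := dist_triangle s z 0
    rw [dist_comm s z, dist_zero_right, dist_zero_right] at h2
    rw [dist_zero_right] at h1
    linarith
  have hdec : ∀ x y y' : ℝ, |x| ≤ δ / 4 → |y| ≤ δ / 4 → |y'| ≤ δ / 4 → y < y' →
      0 ≤ f ⟨x, y'⟩ → 0 < f ⟨x, y⟩ := by
    intro x y y' hx hy hy' hlt hfp
    by_contra! hfq
    set p : ℂ := ⟨x, y'⟩ with hp
    set q : ℂ := ⟨x, y⟩ with hq
    have np : ‖p‖ ≤ δ / 2 := (Complex.norm_le_abs_re_add_abs_im _).trans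
      (by simp only [hp]; linarith)
    have nq : ‖q‖ ≤ δ / 2 := (Complex.norm_le_abs_re_add_abs_im _).trans
      (by simp only [hq]; linarith)
    obtain ⟨b, hb, hpb⟩ := hB.exists_dist_eq_infDist hBne p
    obtain ⟨a, ha, hqa⟩ := hA.exists_dist_eq_infDist hAne q
    have hba := hsep a ha (hnear rfl q a nq hqa) b hb (hnear h0.symm p b np hpb)
    have h1 : dist p b ≤ dist p a := by
      rw [hpb]; exact (sub_nonneg.1 hfp).trans (infDist_le_dist_of_mem ha)
    have h2 : dist q a ≤ dist q b := by
      rw [hqa]; exact (sub_nonpos.1 hfq).trans (infDist_le_dist_of_mem hb)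
    rw [dist_eq_norm, dist_eq_norm] at h1 h2
    have h1' := pow_le_pow_left₀ (norm_nonneg _) h1 2
    have h2' := pow_le_pow_left₀ (norm_nonneg _) h2 2
    simp only [Complex.sq_norm, Complex.normSq_apply, Complex.sub_re, Complex.sub_im, hp, hq]
      at h1' h2'
    nlinarith [mul_pos (sub_pos.2 hlt) (sub_pos.2 hba)]
  set η := δ / 4 with hηdef
  have hη : 0 < η := by positivity
  have habs : |η| ≤ η := (abs_of_pos hη).le
  have htop : f ⟨0, η⟩ < 0 := not_le.1 fun hle ↦
    (hdec 0 0 η (by simpa using hη.le) (by simpa using hη.le) habs hη hle).ne' hf0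
  have hbot : 0 < f ⟨0, -η⟩ := hdec 0 (-η) 0 (by simpa using hη.le) (by simpa using habs)
    (by simpa using hη.le) (by linarith) hf0.ge
  have hline : ∀ y : ℝ, Continuous fun x : ℝ ↦ f ⟨x, y⟩ := fun y ↦
    hf.comp (Complex.equivRealProdCLM.symm.continuous.comp
      (by fun_prop : Continuous fun x : ℝ ↦ (x, y)))
  obtain ⟨ε, hε, hεs⟩ := Metric.eventually_nhds_iff.1
    (((hline η).continuousAt.eventually_lt_const htop).and
      ((hline (-η)).continuousAt.eventually_const_lt hbot))
  have hm : ∀ x : ℝ, |x| < min ε η → f ⟨x, η⟩ < 0 ∧ 0 < f ⟨x, -η⟩ := fun x hx ↦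
    hεs (by simpa using hx.trans_le (min_le_left _ _))
  refine ⟨{z | |z.re| < min ε η ∧ |z.im| < η}, ?_, ?_, ?_⟩
  · exact (isOpen_lt (continuous_abs.comp Complex.continuous_re) continuous_const).inter
      (isOpen_lt (continuous_abs.comp Complex.continuous_im) continuous_const)
  · simp [hε, hη]
  · have hE : equidistantSet A B = {z | f z = 0} := by
      ext z; simp [equidistantSet, f, sub_eq_zero]
    rw [hE]
    exact nonempty_homeomorph_of_vertical_monotone hf (lt_min hε hη) hη
      (fun x y y' hx ↦ hdec x y y' (hx.le.trans (min_le_right _ _)))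
      (fun x hx ↦ (hm x hx).1) fun x hx ↦ (hm x hx).2

theorem Metric.infDist_image_of_dist_eq {X Y : Type*} [MetricSpace X] [MetricSpace Y] {e : X → Y}
    {k : ℝ} (hk : 0 ≤ k) (he : ∀ x y, dist (e x) (e y) = k * dist x y) (S : Set X) (x : X) :
    infDist (e x) (e '' S) = k * infDist x S := by
  rw [infDist_eq_iInf, infDist_eq_iInf, Real.mul_iInf_of_nonneg hk, ← sInf_image', image_image,
    sInf_image']
  simp only [he]

/-- Having a neighbourhood in the equidistant set homeomorphic to `ℝ` is invariant under
similarities. -/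
theorem exists_chart_of_similarity {X Y : Type*} [MetricSpace X] [MetricSpace Y] (e : X ≃ₜ Y)
    {k : ℝ} (hk : 0 < k) (he : ∀ x y, dist (e x) (e y) = k * dist x y) {A B : Set X} {x : X}
    (h : ∃ U : Set Y, IsOpen U ∧ e x ∈ U ∧
      Nonempty ((U ∩ equidistantSet (e '' A) (e '' B) : Set Y) ≃ₜ ℝ)) :
    ∃ U : Set X, IsOpen U ∧ x ∈ U ∧ Nonempty ((U ∩ equidistantSet A B : Set X) ≃ₜ ℝ) := by
  obtain ⟨U, hU, hxU, ⟨φ⟩⟩ := h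
  refine ⟨e ⁻¹' U, hU.preimage e.continuous, hxU, ⟨(e.subtype fun z ↦ ?_).trans φ⟩⟩
  change e z ∈ U ∧ infDist z A = infDist z B ↔
    e z ∈ U ∧ infDist (e z) (e '' A) = infDist (e z) (e '' B)
  rw [infDist_image_of_dist_eq hk.le he, infDist_image_of_dist_eq hk.le he, mul_right_inj' hk.ne']

theorem exists_chart_of_neg_one_mem {A B : Set ℂ} (hA : IsClosed A) (hB : IsClosed B)
    (hAc : IsPreconnected A) (hBc : IsPreconnected B) (hAB : Disjoint A B) (hBne : B.Nonempty)
    (hA1 : infDist 0 A = 1) (hB1 : infDist 0 B = 1) (hmem : (-1 : ℂ) ∈ A) :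
    ∃ U : Set ℂ, IsOpen U ∧ 0 ∈ U ∧ Nonempty ((U ∩ equidistantSet A B : Set ℂ) ≃ₜ ℝ) := by
  have hnorm : ∀ {S : Set ℂ}, infDist 0 S = 1 → ∀ s ∈ S, 1 ≤ ‖s‖ := fun hS s hs ↦ by
    rw [← hS, ← dist_zero_left]
    exact infDist_le_dist_of_mem hs
  obtain ⟨b, hb, hb1⟩ := hB.exists_dist_eq_infDist hBne 0
  obtain ⟨c, hc, hsep⟩ := exists_separating_direction hA hB hAc hBc hAB (hnorm hA1) (hnorm hB1) hmem
    ⟨b, hb, by rw [← dist_zero_left, hb1, hB1]⟩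
  let e := Homeomorph.mulLeft₀ c hc
  have hk : 0 < ‖c‖ := norm_pos_iff.2 hc
  have he : ∀ z w, dist (e z) (e w) = ‖c‖ * dist z w := fun z w ↦ by
    simp only [e, Homeomorph.coe_mulLeft₀, dist_eq_norm, ← mul_sub, norm_mul]
  have he0 : e 0 = 0 := mul_zero c
  have hinf : ∀ S : Set ℂ, infDist 0 (e '' S) = ‖c‖ * infDist 0 S := fun S ↦ by
    rw [← infDist_image_of_dist_eq hk.le he, he0]
  refine exists_chart_of_similarity e hk he ?_
  rw [he0]
  refine exists_chart_at_zero (e.isClosed_image.2 hA) (e.isClosed_image.2 hB)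
    ((nonempty_of_mem hmem).image e) (hBne.image e) (by rw [hinf, hinf, hA1, hB1]) ?_
  rw [hinf, hA1, mul_one]
  have hone : ∀ z, ‖e z‖ = ‖c‖ → ‖z‖ = 1 := fun z hz ↦ by
    simpa [e, hc] using hz
  rintro _ ⟨a, ha, rfl⟩ ha' _ ⟨b, hb, rfl⟩ hb'
  exact hsep a ha (hone a ha') b hb (hone b hb')

/-- If `A` and `B` are nonempty, disjoint, closed, connected subsets of the Euclidean
plane, then the equidistant set `E(A,B)` is connected and every point of `E(A,B)` has an
open neighborhood in the subspace topology homeomorphic to `ℝ`. -/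
theorem equidistantSet_connected_one_manifold
    (A B : Set (EuclideanSpace ℝ (Fin 2)))
    (hA : A.Nonempty) (hB : B.Nonempty) (hAB : Disjoint A B)
    (hAc : IsClosed A) (hBc : IsClosed B)
    (hAconn : IsConnected A) (hBconn : IsConnected B) :
    IsConnected (equidistantSet A B) ∧
      ∀ x ∈ equidistantSet A B, ∃ U : Set (EuclideanSpace ℝ (Fin 2)),
        IsOpen U ∧ x ∈ U ∧
          Nonempty (((U ∩ equidistantSet A B : Set (EuclideanSpace ℝ (Fin 2)))) ≃ₜ ℝ) := by
  refine ⟨isConnected_equidistantSet hAc hBc hAconn hBconn, fun x hx ↦ ?_⟩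
  have hx' : infDist x A = infDist x B := hx
  obtain ⟨a, ha, hxa⟩ := hAc.exists_dist_eq_infDist hA x
  have hr : 0 < infDist x A := by
    refine infDist_nonneg.lt_of_ne' fun h0 ↦ ?_
    exact disjoint_left.1 hAB ((hAc.mem_iff_infDist_zero hA).2 h0)
      ((hBc.mem_iff_infDist_zero hB).2 (hx' ▸ h0))
  let L : EuclideanSpace ℝ (Fin 2) ≃ₗᵢ[ℝ] ℂ := Complex.orthonormalBasisOneI.repr.symm
  have hd : dist (L x) (L a) = infDist x A := by rw [L.dist_map, hxa]
  have hne : L x - L a ≠ 0 := sub_ne_zero.2 (dist_pos.1 (hd ▸ hr))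
  have hc : (L x - L a)⁻¹ ≠ 0 := inv_ne_zero hne
  let e : EuclideanSpace ℝ (Fin 2) ≃ₜ ℂ :=
    (L.toHomeomorph.trans (Homeomorph.subRight (L x))).trans (Homeomorph.mulLeft₀ _ hc)
  have he_apply : ∀ y, e y = (L x - L a)⁻¹ * (L y - L x) := fun y ↦ rfl
  have hk : 0 < (infDist x A)⁻¹ := inv_pos.2 hr
  have he : ∀ y z, dist (e y) (e z) = (infDist x A)⁻¹ * dist y z := fun y z ↦ by
    rw [he_apply, he_apply, dist_eq_norm, ← mul_sub, norm_mul, norm_inv, ← dist_eq_norm (L x), hd,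
      sub_sub_sub_cancel_right, ← dist_eq_norm, L.dist_map]
  have he0 : e x = 0 := by rw [he_apply, sub_self, mul_zero]
  refine exists_chart_of_similarity e hk he ?_
  rw [he0]
  refine exists_chart_of_neg_one_mem (e.isClosed_image.2 hAc) (e.isClosed_image.2 hBc)
    (hAconn.isPreconnected.image e e.continuous.continuousOn)
    (hBconn.isPreconnected.image e e.continuous.continuousOn)
    ((disjoint_image_iff e.injective).2 hAB) (hB.image e) ?_ ?_ ⟨a, ha, ?_⟩
  · rw [← he0, infDist_image_of_dist_eq hk.le he, inv_mul_cancel₀ hr.ne']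
  · rw [← he0, infDist_image_of_dist_eq hk.le he, ← hx', inv_mul_cancel₀ hr.ne']
  · rw [he_apply, ← neg_sub (L x) (L a), mul_neg, inv_mul_cancel₀ hne]
end

section
/- Let A and B be nonempty, disjoint, closed, connected subsets of the Euclidean plane ℝ². Then the equidistant set E(A,B) is connected. -/
open Metric Set

/-- A point on a segment from `x` to a nearest point of `A` stays at least as close to `A` as to
`B`, so the set of such points is connected when `A` is. -/
theorem isPreconnected_setOf_infDist_le {E : Type*} [NormedAddCommGroup E] [NormedSpace ℝ E]
    [ProperSpace E] {A B : Set E} (hAc : IsClosed A) (hA : IsConnected A) :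
    IsPreconnected {x | infDist x A ≤ infDist x B} := by
  have hsub : A ⊆ {x | infDist x A ≤ infDist x B} := fun x hx ↦ by
    simpa only [mem_ofPred_eq, infDist_zero_of_mem hx] using infDist_nonneg
  obtain ⟨a₀, ha₀⟩ := hA.nonempty
  refine isPreconnected_of_forall a₀ fun x hx ↦ ?_
  obtain ⟨a, ha, hxa⟩ := hAc.exists_infDist_eq_dist hA.nonempty x
  refine ⟨A ∪ segment ℝ x a, union_subset hsub fun y hy ↦ ?_, .inl ha₀,
    .inr (left_mem_segment ℝ x a),
    hA.isPreconnected.union a ha (right_mem_segment ℝ x a) (convex_segment x a).isPreconnected⟩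
  have hseg := dist_add_dist_of_mem_segment hy
  have hyA : infDist y A ≤ dist y a := infDist_le_dist_of_mem ha
  have hxB : infDist x B ≤ infDist y B + dist x y := infDist_le_infDist_add_dist
  simp only [mem_ofPred_eq] at hx ⊢
  linarith

/-- A simply connected, locally path-connected normal space is unicoherent: if it is the union of
two closed connected sets, then their intersection is connected. -/
theorem IsPreconnected.inter_of_union_eq_univ {X : Type*} [TopologicalSpace X] [NormalSpace X]
    [SimplyConnectedSpace X] [LocallyPathConnectedSpace X] {F G : Set X}
    (hF : IsPreconnected F) (hG : IsPreconnected G) (hFc : IsClosed F) (hGc : IsClosed G)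
    (hFG : F ∪ G = univ) : IsPreconnected (F ∩ G) := by
  classical
  rw [isPreconnected_iff_subset_of_fully_disjoint_closed (hFc.inter hGc)]
  intro u v hu hv huv hdisj
  by_contra! hne
  obtain ⟨q, hq, hqu⟩ := not_subset.mp hne.1
  obtain ⟨p, hp, hpv⟩ := not_subset.mp hne.2
  have hpu : p ∈ u := (huv hp).resolve_right hpv
  have hqv : q ∈ v := (huv hq).resolve_left hqu
  obtain ⟨w, hw₀, hw₁, -⟩ := exists_continuous_zero_one_of_isClosed hu hv hdisj
  have hexp_pi : Circle.exp Real.pi = Circle.exp (-Real.pi) :=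
    Circle.exp_eq_exp.mpr ⟨1, by push_cast; ring⟩
  have hagree : ∀ x ∈ F ∩ G, Circle.exp (Real.pi * w x) = Circle.exp (-(Real.pi * w x)) := by
    intro x hx
    rcases huv hx with h | h
    · simp [hw₀ h]
    · simpa [hw₁ h] using hexp_pi
  have hcompl : Fᶜ ⊆ G := fun x hx ↦ (hFG.symm ▸ mem_univ x : x ∈ F ∪ G).resolve_left hx
  have hfrontier : frontier F ⊆ F ∩ G := by
    rw [frontier_eq_closure_inter_closure, hFc.closure_eq]
    exact inter_subset_inter_right F (closure_minimal hcompl hGc)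
  let f : C(X, Circle) :=
    ⟨F.piecewise (fun x ↦ Circle.exp (Real.pi * w x)) fun x ↦ Circle.exp (-(Real.pi * w x)),
      Continuous.piecewise (fun x hx ↦ hagree x (hfrontier hx)) (by fun_prop) (by fun_prop)⟩
  have hfF : EqOn f (fun x ↦ Circle.exp (Real.pi * w x)) F := piecewise_eqOn _ _ _
  have hfFc : EqOn f (fun x ↦ Circle.exp (-(Real.pi * w x))) Fᶜ := piecewise_eqOn_compl _ _ _
  have hfG : EqOn f (fun x ↦ Circle.exp (-(Real.pi * w x))) G := fun x hx ↦ by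
    by_cases hxF : x ∈ F
    · exact (hfF hxF).trans (hagree x ⟨hxF, hx⟩)
    · exact hfFc hxF
  have hwp : w p = 0 := hw₀ hpu
  have hwq : w q = 1 := hw₁ hqv
  obtain ⟨φ, ⟨hφp, hφ⟩, -⟩ := Circle.isCoveringMap_exp.existsUnique_continuousMap_lifts f p 0
    (by simp [hfF hp.1, hwp])
  have hφF : EqOn φ (fun x ↦ Real.pi * w x) F :=
    Circle.isCoveringMap_exp.eqOn_of_comp_eqOn hF (by fun_prop) (by fun_prop)
      (fun x hx ↦ (congrFun hφ x).trans (hfF hx)) hp.1 (by simp [hφp, hwp])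
  have hφG : EqOn φ (fun x ↦ -(Real.pi * w x)) G :=
    Circle.isCoveringMap_exp.eqOn_of_comp_eqOn hG (by fun_prop) (by fun_prop)
      (fun x hx ↦ (congrFun hφ x).trans (hfG hx)) hp.2 (by simp [hφp, hwp])
  have hq_eq := (hφF hq.1).symm.trans (hφG hq.2)
  simp only [hwq, mul_one] at hq_eq
  linarith [Real.pi_pos]

/-- If `A` and `B` are nonempty, disjoint, closed, connected subsets of the Euclidean
plane, then the equidistant set `E(A,B)` is connected. -/
theorem equidistantSet_isConnected
    (A B : Set (EuclideanSpace ℝ (Fin 2)))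
    (hA : A.Nonempty) (hB : B.Nonempty) (hAB : Disjoint A B)
    (hAc : IsClosed A) (hBc : IsClosed B)
    (hAconn : IsConnected A) (hBconn : IsConnected B) :
    IsConnected (equidistantSet A B) := by
  have hF : IsClosed {x | infDist x A ≤ infDist x B} :=
    isClosed_le (continuous_infDist_pt A) (continuous_infDist_pt B)
  have hG : IsClosed {x | infDist x B ≤ infDist x A} :=
    isClosed_le (continuous_infDist_pt B) (continuous_infDist_pt A)
  have hFG : {x | infDist x A ≤ infDist x B} ∪ {x | infDist x B ≤ infDist x A} = univ :=
    eq_univ_of_forall fun x ↦ le_total (infDist x A) (infDist x B)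
  have hE : equidistantSet A B =
      {x | infDist x A ≤ infDist x B} ∩ {x | infDist x B ≤ infDist x A} :=
    ext fun _ ↦ le_antisymm_iff
  rw [hE]
  refine ⟨?_, (isPreconnected_setOf_infDist_le hAc hAconn).inter_of_union_eq_univ
    (isPreconnected_setOf_infDist_le hBc hBconn) hF hG hFG⟩
  obtain ⟨a, ha⟩ := hA
  obtain ⟨b, hb⟩ := hB
  obtain ⟨x, -, hx⟩ := isPreconnected_closed_iff.mp isPreconnected_univ _ _ hF hG hFG.ge
    ⟨a, mem_univ a, by simpa only [mem_ofPred_eq, infDist_zero_of_mem ha] using infDist_nonneg⟩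
    ⟨b, mem_univ b, by simpa only [mem_ofPred_eq, infDist_zero_of_mem hb] using infDist_nonneg⟩
  exact ⟨x, hx⟩
end
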